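/- The SPRCN-representable real numbers are closed under subtraction: if x and y are SPRCN-representable real numbers, then x − y is SPRCN-representable. -/

import Mathlib

open Filter

def SPRCNRep (x : ℝ) : Prop :=
  ∃ (I : ℤ) (P : ℕ → ℤ), Primrec P ∧ (∀ i, P i = -1 ∨ P i = 0 ∨ P i = 1) ∧
    Tendsto (fun n => (I : ℝ) + ∑ i ∈ Finset.Icc 1 n, (P i : ℝ) / 2 ^ i)
      atTop (nhds x)

/-- Every function agrees on a finite set with a primitive recursive function. -/
theorem Primrec.exists_eqOn_finset {α β : Type*} [Primcodable α] [Primcodable β] [DecidableEq α]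
    [Inhabited β] (g : α → β) (s : Finset α) : ∃ h : α → β, Primrec h ∧ ∀ a ∈ s, h a = g a := by
  induction s using Finset.induction_on with
  | empty => exact ⟨fun _ => default, Primrec.const _, by simp⟩
  | insert a s _ ih =>
    obtain ⟨h, hh, hs⟩ := ih
    refine ⟨fun x => if x = a then g a else h x,
      Primrec.ite (Primrec.eq.comp Primrec.id (Primrec.const a)) (Primrec.const _) hh, ?_⟩
    intro x hx
    by_cases hxa : x = a
    · simp [hxa]
    · simpa [hxa] using hs x ((Finset.mem_insert.1 hx).resolve_left hxa)

/-- Composing a primitive recursive function of finite range with any function yields a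
primitive recursive function. -/
theorem Primrec.comp_of_forall_mem_finset {α β γ : Type*} [Primcodable α] [Primcodable β]
    [Primcodable γ] [DecidableEq β] [Inhabited γ] {f : α → β} (hf : Primrec f) (s : Finset β)
    (hs : ∀ a, f a ∈ s) (g : β → γ) : Primrec fun a => g (f a) := by
  obtain ⟨h, hh, hg⟩ := Primrec.exists_eqOn_finset g s
  exact (hh.comp hf).of_eq fun a => hg _ (hs a)

/-- The carry out of a position holding the digit `d ∈ {-2, …, 2}`, when the next less
significant position holds `e`. -/
def signedCarry (d e : ℤ) : ℤ :=
  if d = 2 then 1 else if d = -2 then -1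
  else if d = 1 then (if 0 < e then 1 else 0)
  else if d = -1 then (if 0 < e then 0 else -1)
  else 0

/-- The digit left at a position holding `d`, when the next two less significant positions
hold `e` and `f`, after all carries are performed simultaneously. -/
def signedDigit (d e f : ℤ) : ℤ :=
  d - 2 * signedCarry d e + signedCarry e f

theorem abs_signedCarry_le (d e : ℤ) : |signedCarry d e| ≤ 1 := by
  unfold signedCarry
  split_ifs <;> simp

theorem signedDigit_mem {d e : ℤ} (f : ℤ) (hd : |d| ≤ 2) (he : |e| ≤ 2) :
    signedDigit d e f = -1 ∨ signedDigit d e f = 0 ∨ signedDigit d e f = 1 := by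
  rw [abs_le] at hd he
  unfold signedDigit signedCarry
  split_ifs <;> omega

theorem sum_signedDigit (d : ℕ → ℤ) (n : ℕ) :
    ∑ i ∈ Finset.Icc 1 n, (signedDigit (d i) (d (i + 1)) (d (i + 2)) : ℝ) / 2 ^ i =
      ∑ i ∈ Finset.Icc 1 n, (d i : ℝ) / 2 ^ i - signedCarry (d 1) (d 2)
        + (signedCarry (d (n + 1)) (d (n + 2)) : ℝ) / 2 ^ n := by
  induction n with
  | zero => simp
  | succ n ih =>
    rw [Finset.sum_Icc_succ_top (by omega), Finset.sum_Icc_succ_top (by omega), ih, signedDigit]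
    push_cast
    field_simp
    ring

theorem tendsto_signedCarry_div_two_pow (d : ℕ → ℤ) :
    Tendsto (fun n => (signedCarry (d (n + 1)) (d (n + 2)) : ℝ) / 2 ^ n) atTop (nhds 0) := by
  refine squeeze_zero_norm (a := fun n : ℕ => (1 / 2 : ℝ) ^ n) (fun n => ?_)
    (tendsto_pow_atTop_nhds_zero_of_lt_one (by norm_num) (by norm_num))
  have h : |(signedCarry (d (n + 1)) (d (n + 2)) : ℝ)| ≤ 1 := by
    exact_mod_cast abs_signedCarry_le _ _
  rw [Real.norm_eq_abs, abs_div, abs_of_pos (by positivity : (0 : ℝ) < 2 ^ n), one_div_pow]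
  gcongr

theorem stmt_9 (x y : ℝ) (hx : SPRCNRep x) (hy : SPRCNRep y) :
    SPRCNRep (x - y) := by
  obtain ⟨I, P, hP, hPd, hPx⟩ := hx
  obtain ⟨J, Q, hQ, hQd, hQy⟩ := hy
  set d : ℕ → ℤ := fun i => P i - Q i with hd
  have hdig (i : ℕ) : |d i| ≤ 2 := by
    rw [abs_le]
    have := hPd i
    have := hQd i
    simp only [hd]
    omega
  have hdprim : Primrec d := by
    refine Primrec.comp_of_forall_mem_finset (hP.pair hQ) (({-1, 0, 1} : Finset ℤ) ×ˢ {-1, 0, 1})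
      (fun i => ?_) (fun p => p.1 - p.2)
    simpa using ⟨hPd i, hQd i⟩
  refine ⟨I - J + signedCarry (d 1) (d 2), fun i => signedDigit (d i) (d (i + 1)) (d (i + 2)),
    ?_, fun i => signedDigit_mem _ (hdig i) (hdig (i + 1)), ?_⟩
  · have hd1 : Primrec fun i => d (i + 1) := hdprim.comp Primrec.succ
    have hd2 : Primrec fun i => d (i + 2) := hd1.comp Primrec.succ
    refine Primrec.comp_of_forall_mem_finset (hdprim.pair (hd1.pair hd2))
      (Finset.Icc (-2) 2 ×ˢ Finset.Icc (-2) 2 ×ˢ Finset.Icc (-2) 2)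
      (fun i => ?_) (fun p => signedDigit p.1 p.2.1 p.2.2)
    simp only [Finset.mem_product, Finset.mem_Icc]
    exact ⟨abs_le.1 (hdig i), abs_le.1 (hdig (i + 1)), abs_le.1 (hdig (i + 2))⟩
  · have h := (hPx.sub hQy).add (tendsto_signedCarry_div_two_pow d)
    rw [add_zero] at h
    refine h.congr fun n => ?_
    rw [sum_signedDigit]
    simp only [hd, Int.cast_sub, Int.cast_add, sub_div, Finset.sum_sub_distrib]
    ring
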